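/- Let p be a prime, s a positive integer, and N > 1 an integer such that N − 1 divides p^{4s} − 1. Consider the cyclotomic cosets modulo N − 1 with respect to p^{2s}, with minimal representatives 0 = a_0 < a_1 < ⋯ < a_z. Let t be an index with 1 ≤ t < z such that a_t < (N − 1)/(p^s + 1). Put Δ = I_{a_1} ∪ I_{a_2} ∪ ⋯ ∪ I_{a_t} and let C = E_Δ ∩ F_{p^{2s}}^{N−1} be the subfield-subcode of the code E_Δ ⊆ F_{p^{4s}}^{N−1} (evaluation at the (N−1)-th roots of unity in F_{p^{4s}}). Then C ⊆ C^{⊥_h}, where ⊥_h is the Hermitian dual on F_{p^{2s}}^{N−1} given by x·_h y = Σ_i x_i y_i^{p^s}; dim_{F_{p^{2s}}} C = card(Δ); and every nonzero codeword of C^{⊥_h} has Hamming weight at least a_{t+1}. Moreover card(Δ) ≤ 2t, with equality whenever gcd(N − 1, p^s − 1) = 1. -/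

import Mathlib

/-- The set `U` of `n`-th roots of unity in `F` (the evaluation points). -/
def rootsSet (F : Type) [Field F] [Fintype F] [DecidableEq F] (n : ℕ) : Finset F :=
  Finset.univ.filter (fun α => α ^ n = 1)

/-- The evaluation code `E_Δ ⊆ F^{n}`: the `F`-span of the vectors `(α^d)_{α ∈ U}`, `d ∈ Δ`. -/
noncomputable def evalCode (F : Type) [Field F] [Fintype F] [DecidableEq F] (n : ℕ)
    (Δ : Set ℕ) : Submodule F (↥(rootsSet F n) → F) :=
  Submodule.span F { v | ∃ d ∈ Δ, v = fun α : ↥(rootsSet F n) => (α : F) ^ d }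

/-- The subfield-subcode `E_Δ ∩ F_{q₀}^n`. -/
noncomputable def subfieldSubcode (F : Type) [Field F] [Fintype F] [DecidableEq F]
    (n q₀ : ℕ) (Δ : Set ℕ) : Set (↥(rootsSet F n) → F) :=
  { v | v ∈ evalCode F n Δ ∧ ∀ i, v i ^ q₀ = v i }

/-- `x` is the minimal representative of its cyclotomic coset modulo `n`
with respect to `b`. -/
def IsMinRep (b n x : ℕ) : Prop :=
  x < n ∧ ∀ i : ℕ, x ≤ (x * b ^ i) % n

/-- The union `Δ = I_{a 1} ∪ ⋯ ∪ I_{a t}` of cyclotomic cosets. -/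
def unionCosets (b n t : ℕ) (a : ℕ → ℕ) : Set ℕ :=
  { x | ∃ i, 1 ≤ i ∧ i ≤ t ∧ ∃ k : ℕ, x = (a i * b ^ k) % n }

section EvaluationCode

variable {F : Type} [Field F] [Fintype F] [DecidableEq F]

theorem exists_isPrimitiveRoot_of_dvd_card_sub_one {n : ℕ} (h : n ∣ Fintype.card F - 1) :
    ∃ ζ : F, IsPrimitiveRoot ζ n := by
  obtain ⟨g, hg⟩ := IsCyclic.exists_ofOrder_eq_natCard (α := Fˣ)
  have hcard : orderOf g = Fintype.card F - 1 := by
    rw [hg, Nat.card_eq_fintype_card, Fintype.card_units]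
  obtain ⟨k, hk⟩ := h
  refine ⟨((g ^ k : Fˣ) : F), IsPrimitiveRoot.coe_units_iff.2 ?_⟩
  refine IsPrimitiveRoot.pow (orderOf_pos g) (IsPrimitiveRoot.orderOf g) ?_
  rw [hcard, hk, mul_comm]

theorem exists_pow_ne_self {b : ℕ} (hb : 1 < b) (hF : Fintype.card F = b * b) :
    ∃ θ : F, θ ^ b ≠ θ := by
  obtain ⟨θ, hθ⟩ := exists_isPrimitiveRoot_of_dvd_card_sub_one (dvd_refl (Fintype.card F - 1))
  have hlt : b < b * b := by nlinarith
  refine ⟨θ, fun hθb => ?_⟩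
  have hθ0 : θ ≠ 0 := hθ.ne_zero (by omega)
  have h1 : θ ^ (b - 1) = 1 := by
    rw [pow_sub₀ θ hθ0 hb.le, hθb, pow_one, mul_inv_cancel₀ hθ0]
  have := Nat.le_of_dvd (by omega) (hθ.dvd_of_pow_eq_one _ h1)
  omega

theorem mem_rootsSet {n : ℕ} {x : F} : x ∈ rootsSet F n ↔ x ^ n = 1 := by
  simp [rootsSet]

theorem card_rootsSet {n : ℕ} (hn : 0 < n) (h : n ∣ Fintype.card F - 1) :
    (rootsSet F n).card = n := by
  obtain ⟨ζ, hζ⟩ := exists_isPrimitiveRoot_of_dvd_card_sub_one h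
  have : rootsSet F n = Polynomial.nthRootsFinset n 1 := by
    ext x
    rw [mem_rootsSet, Polynomial.mem_nthRootsFinset hn]
  rw [this, hζ.card_nthRootsFinset]

theorem sum_rootsSet_pow_eq_zero {n k : ℕ} (hn : 0 < n) (h : n ∣ Fintype.card F - 1)
    (hk : ¬ n ∣ k) : ∑ α : ↥(rootsSet F n), (α : F) ^ k = 0 := by
  obtain ⟨ζ, hζ⟩ := exists_isPrimitiveRoot_of_dvd_card_sub_one h
  have hζ0 : ζ ≠ 0 := hζ.ne_zero hn.ne'
  rw [Finset.sum_coe_sort (rootsSet F n) (fun α => α ^ k)]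
  have key : ∑ α ∈ rootsSet F n, (ζ * α) ^ k = ∑ α ∈ rootsSet F n, α ^ k := by
    refine Finset.sum_bij' (fun α _ => ζ * α) (fun α _ => ζ⁻¹ * α) ?_ ?_ ?_ ?_ ?_
    · intro α hα
      rw [mem_rootsSet] at hα ⊢
      rw [mul_pow, hζ.pow_eq_one, hα, one_mul]
    · intro α hα
      rw [mem_rootsSet] at hα ⊢
      rw [mul_pow, inv_pow, hζ.pow_eq_one, hα, inv_one, one_mul]
    · intro α _
      exact inv_mul_cancel_left₀ hζ0 α
    · intro α _
      exact mul_inv_cancel_left₀ hζ0 α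
    · intro α _
      rfl
  simp only [mul_pow, ← Finset.mul_sum] at key
  have hne : ζ ^ k - 1 ≠ 0 := fun h0 => hk (hζ.dvd_of_pow_eq_one k (sub_eq_zero.1 h0))
  refine (mul_eq_zero.1 (?_ : (ζ ^ k - 1) * _ = 0)).resolve_left hne
  rw [sub_mul, key, one_mul, sub_self]

theorem rootsSet_pow_mod {n : ℕ} (α : ↥(rootsSet F n)) (d : ℕ) :
    (α : F) ^ (d % n) = (α : F) ^ d :=
  (pow_eq_pow_mod d (mem_rootsSet.1 α.2)).symm

theorem pow_mem_evalCode {n : ℕ} {Δ : Set ℕ} {d : ℕ} (hd : d ∈ Δ) :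
    (fun α : ↥(rootsSet F n) => (α : F) ^ d) ∈ evalCode F n Δ :=
  Submodule.subset_span ⟨d, hd, rfl⟩

theorem linearIndependent_rootsSet_pow {n : ℕ} (hn : 0 < n) (h : n ∣ Fintype.card F - 1)
    {Δ : Set ℕ} (hΔ : ∀ d ∈ Δ, d < n) :
    LinearIndependent F (fun (d : Δ) (α : ↥(rootsSet F n)) => (α : F) ^ (d : ℕ)) := by
  classical
  rw [linearIndependent_iff']
  intro S c hc d hd
  set P : Polynomial F := ∑ e ∈ S, Polynomial.monomial (e : ℕ) (c e) with hP
  have hP0 : P = 0 := by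
    refine Polynomial.eq_zero_of_degree_lt_of_eval_finset_eq_zero (rootsSet F n) ?_ ?_
    · rw [card_rootsSet hn h]
      refine (Polynomial.degree_sum_le _ _).trans_lt ?_
      refine (Finset.sup_lt_iff (WithBot.bot_lt_coe n)).2 ?_
      intro e _
      exact (Polynomial.degree_monomial_le _ _).trans_lt (Nat.cast_lt.2 (hΔ e e.2))
    · intro x hx
      have := congrFun hc ⟨x, hx⟩
      simpa [hP, Polynomial.eval_finsetSum] using this
  have hcoeff : P.coeff (d : ℕ) = c d := by
    simp [hP, Polynomial.coeff_monomial, Subtype.ext_iff.symm, hd]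
  rw [← hcoeff, hP0, Polynomial.coeff_zero]

theorem card_evalCode {n : ℕ} (hn : 0 < n) (h : n ∣ Fintype.card F - 1)
    {Δ : Set ℕ} (hΔ : ∀ d ∈ Δ, d < n) :
    Nat.card (evalCode F n Δ) = Fintype.card F ^ Nat.card Δ := by
  have : Fintype Δ := ((Set.finite_lt_nat n).subset hΔ).fintype
  have hspan : evalCode F n Δ = Submodule.span F
      (Set.range fun (d : Δ) (α : ↥(rootsSet F n)) => (α : F) ^ (d : ℕ)) := by
    rw [evalCode]
    congr 1
    ext v
    simp [eq_comm]
  rw [Module.natCard_eq_pow_finrank (K := F), hspan,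
    finrank_span_eq_card (linearIndependent_rootsSet_pow hn h hΔ), Nat.card_eq_fintype_card,
    Nat.card_eq_fintype_card]

section Frobenius

variable {p : ℕ} [Fact p.Prime] [CharP F p]

theorem sum_mul_pow_eq_zero_of_mem_evalCode {n m : ℕ} (hn : 0 < n)
    (h : n ∣ Fintype.card F - 1) {Δ : Set ℕ}
    (hΔ : ∀ d ∈ Δ, ∀ e ∈ Δ, ¬ n ∣ d + e * p ^ m) {x y : ↥(rootsSet F n) → F}
    (hx : x ∈ evalCode F n Δ) (hy : y ∈ evalCode F n Δ) : ∑ i, x i * y i ^ p ^ m = 0 := by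
  induction hx using Submodule.span_induction with
  | mem x hx =>
    obtain ⟨d, hd, rfl⟩ := hx
    induction hy using Submodule.span_induction with
    | mem y hy =>
      obtain ⟨e, he, rfl⟩ := hy
      simpa only [← pow_mul, ← pow_add] using sum_rootsSet_pow_eq_zero hn h (hΔ d hd e he)
    | zero => simp [(Fact.out : p.Prime).ne_zero]
    | add y z _ _ hy hz =>
      simp only [Pi.add_apply, add_pow_char_pow, mul_add, Finset.sum_add_distrib, hy, hz, add_zero]
    | smul c y _ hy =>
      simp only [Pi.smul_apply, smul_eq_mul, mul_pow, mul_left_comm _ (c ^ p ^ m),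
        ← Finset.mul_sum] at hy ⊢
      rw [hy, mul_zero]
  | zero => simp
  | add x z _ _ hx hz =>
    simp only [Pi.add_apply, add_mul, Finset.sum_add_distrib, hx, hz, add_zero]
  | smul c x _ hx =>
    simp only [Pi.smul_apply, smul_eq_mul, mul_assoc, ← Finset.mul_sum, hx, mul_zero]

theorem frobenius_mem_evalCode {n m : ℕ} {Δ : Set ℕ} (hΔ : ∀ d ∈ Δ, (d * p ^ m) % n ∈ Δ)
    {v : ↥(rootsSet F n) → F} (hv : v ∈ evalCode F n Δ) :
    (fun i => v i ^ p ^ m) ∈ evalCode F n Δ := by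
  induction hv using Submodule.span_induction with
  | mem v hv =>
    obtain ⟨d, hd, rfl⟩ := hv
    simpa only [rootsSet_pow_mod, pow_mul] using pow_mem_evalCode (F := F) (n := n) (hΔ d hd)
  | zero =>
    have h0 : (p ^ m) ≠ 0 := pow_ne_zero _ (Fact.out : p.Prime).ne_zero
    simp only [Pi.zero_apply, zero_pow h0]
    exact Submodule.zero_mem _
  | add v w _ _ hv hw =>
    simp only [Pi.add_apply, add_pow_char_pow]
    exact Submodule.add_mem _ hv hw
  | smul c v _ hv =>
    simp only [Pi.smul_apply, smul_eq_mul, mul_pow]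
    exact Submodule.smul_mem _ (c ^ p ^ m) hv

/-- Galois descent for the quadratic extension `F / F_{p^m}`: a Frobenius-stable evaluation code
is spanned over `F` by its subfield-subcode. -/
theorem exists_add_smul_of_mem_evalCode {n m : ℕ} {Δ : Set ℕ}
    (hF : Fintype.card F = p ^ m * p ^ m)
    (hΔ : ∀ d ∈ Δ, (d * p ^ m) % n ∈ Δ) {θ : F} (hθ : θ ^ p ^ m ≠ θ)
    {v : ↥(rootsSet F n) → F} (hv : v ∈ evalCode F n Δ) :
    ∃ u ∈ subfieldSubcode F n (p ^ m) Δ, ∃ w ∈ subfieldSubcode F n (p ^ m) Δ, v = u + θ • w := by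
  have hfix (x : F) : (x ^ p ^ m) ^ p ^ m = x := by rw [← pow_mul, ← hF, FiniteField.pow_card]
  have hδ : θ ^ p ^ m - θ ≠ 0 := sub_ne_zero.2 hθ
  set w : ↥(rootsSet F n) → F := (θ ^ p ^ m - θ)⁻¹ • ((fun i => v i ^ p ^ m) - v) with hw
  have hwE : w ∈ evalCode F n Δ :=
    Submodule.smul_mem _ _ (Submodule.sub_mem _ (frobenius_mem_evalCode hΔ hv) hv)
  have hw_apply (i) : (θ ^ p ^ m - θ) * w i = v i ^ p ^ m - v i := by
    simp [hw, mul_inv_cancel_left₀ hδ]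
  have hwb (i) : w i ^ p ^ m = w i := by
    have h1 := congrArg (· ^ p ^ m) (hw_apply i)
    simp only [mul_pow, sub_pow_char_pow, hfix] at h1
    refine mul_left_cancel₀ hδ ?_
    linear_combination -h1 - hw_apply i
  refine ⟨v - θ • w, ⟨Submodule.sub_mem _ hv (Submodule.smul_mem _ _ hwE), fun i => ?_⟩,
    w, ⟨hwE, hwb⟩, (sub_add_cancel _ _).symm⟩
  simp only [Pi.sub_apply, Pi.smul_apply, smul_eq_mul, sub_pow_char_pow, mul_pow, hwb]
  linear_combination -hw_apply i

theorem card_subfieldSubcode {n m : ℕ} (hn : 0 < n) (hm : 0 < m)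
    (hF : Fintype.card F = p ^ m * p ^ m) (h : n ∣ Fintype.card F - 1) {Δ : Set ℕ}
    (hlt : ∀ d ∈ Δ, d < n) (hΔ : ∀ d ∈ Δ, (d * p ^ m) % n ∈ Δ) :
    Nat.card (subfieldSubcode F n (p ^ m) Δ) = (p ^ m) ^ Nat.card Δ := by
  obtain ⟨θ, hθ⟩ := exists_pow_ne_self
    (Nat.one_lt_pow hm.ne' (Fact.out : p.Prime).one_lt) hF
  let φ : subfieldSubcode F n (p ^ m) Δ × subfieldSubcode F n (p ^ m) Δ → evalCode F n Δ :=
    fun x => ⟨x.1.1 + θ • x.2.1,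
      Submodule.add_mem _ x.1.2.1 (Submodule.smul_mem _ _ x.2.2.1)⟩
  have hφ : Function.Bijective φ := by
    constructor
    · rintro ⟨⟨u, _, hu⟩, ⟨w, _, hw⟩⟩ ⟨⟨u', _, hu'⟩, ⟨w', _, hw'⟩⟩ heq
      have h1 (i) : u i + θ * w i = u' i + θ * w' i := congrFun (congrArg Subtype.val heq) i
      have h2 (i) : w i = w' i := by
        have h3 := congrArg (· ^ p ^ m) (h1 i)
        simp only [mul_pow, add_pow_char_pow, hu, hu', hw, hw'] at h3
        refine mul_left_cancel₀ (sub_ne_zero.2 hθ) ?_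
        linear_combination h3 - h1 i
      obtain rfl : w = w' := funext h2
      obtain rfl : u = u' := funext fun i => add_right_cancel (h1 i)
      rfl
    · rintro ⟨v, hv⟩
      obtain ⟨u, hu, w, hw, rfl⟩ := exists_add_smul_of_mem_evalCode hF hΔ hθ hv
      exact ⟨(⟨u, hu⟩, ⟨w, hw⟩), rfl⟩
  have hcard := Nat.card_congr (Equiv.ofBijective φ hφ)
  rw [Nat.card_prod, card_evalCode hn h hlt, hF, mul_pow] at hcard
  exact Nat.mul_self_inj.1 hcard

theorem sum_mul_eq_zero_of_subfieldSubcode {n m : ℕ} (hm : 0 < m)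
    (hF : Fintype.card F = p ^ m * p ^ m) {Δ : Set ℕ} (hΔ : ∀ d ∈ Δ, (d * p ^ m) % n ∈ Δ)
    {w : ↥(rootsSet F n) → F} (hw : ∀ x ∈ subfieldSubcode F n (p ^ m) Δ, ∑ i, x i * w i = 0)
    {v : ↥(rootsSet F n) → F} (hv : v ∈ evalCode F n Δ) : ∑ i, v i * w i = 0 := by
  obtain ⟨θ, hθ⟩ := exists_pow_ne_self
    (Nat.one_lt_pow hm.ne' (Fact.out : p.Prime).one_lt) hF
  obtain ⟨x, hx, y, hy, rfl⟩ := exists_add_smul_of_mem_evalCode hF hΔ hθ hv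
  simp only [Pi.add_apply, Pi.smul_apply, smul_eq_mul, add_mul, mul_assoc,
    Finset.sum_add_distrib, ← Finset.mul_sum, hw x hx, hw y hy, mul_zero, add_zero]

end Frobenius

/-- The BCH bound for the zeros `1, …, δ - 1`. -/
theorem le_card_support_of_sum_pow_mul_eq_zero {n δ : ℕ} (hn : 0 < n)
    {w : ↥(rootsSet F n) → F}
    (hw : ∀ d, 1 ≤ d → d < δ → ∑ i : ↥(rootsSet F n), (i : F) ^ d * w i = 0) (hw0 : w ≠ 0) :
    δ ≤ (Finset.univ.filter fun i => w i ≠ 0).card := by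
  by_contra! hlt
  obtain ⟨β, hβ⟩ := Function.ne_iff.1 hw0
  set S := Finset.univ.filter fun i => w i ≠ 0
  have hβS : β ∈ S := by simpa [S] using hβ
  set P : Polynomial F := ∏ γ ∈ S.erase β, (Polynomial.X - Polynomial.C (γ : F)) with hP
  have hdeg : P.natDegree + 1 = S.card := by
    rw [hP, Polynomial.natDegree_finsetProd_X_sub_C_eq_card, Finset.card_erase_add_one hβS]
  have hzero : ∑ i : ↥(rootsSet F n), ((i : F) * P.eval (i : F)) * w i = 0 := by
    simp only [Polynomial.eval_eq_sum_range, Finset.mul_sum, Finset.sum_mul]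
    rw [Finset.sum_comm]
    refine Finset.sum_eq_zero fun d hd => ?_
    have h1 := hw (d + 1) (by omega) (by rw [Finset.mem_range] at hd; omega)
    rw [← mul_zero (P.coeff d), ← h1, Finset.mul_sum]
    exact Finset.sum_congr rfl fun i _ => by ring
  rw [Finset.sum_eq_single β] at hzero
  · have hβ0 : (β : F) ≠ 0 := fun h0 => by
      have := mem_rootsSet.1 β.2
      rw [h0, zero_pow hn.ne'] at this
      exact zero_ne_one this
    have hPβ : P.eval (β : F) ≠ 0 := by
      rw [hP, Polynomial.eval_prod, Finset.prod_ne_zero_iff]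
      intro γ hγ
      simpa [sub_eq_zero, Subtype.ext_iff.symm] using (Finset.ne_of_mem_erase hγ).symm
    exact mul_ne_zero (mul_ne_zero hβ0 hPβ) hβ hzero
  · intro γ _ hγ
    by_cases hγ0 : w γ = 0
    · rw [hγ0, mul_zero]
    · have : P.eval (γ : F) = 0 := by
        rw [hP, Polynomial.eval_prod]
        exact Finset.prod_eq_zero (Finset.mem_erase.2 ⟨hγ, by simpa [S] using hγ0⟩) (by simp)
      rw [this, mul_zero, zero_mul]
  · simp

end EvaluationCode

section CyclotomicCosets

variable {b n : ℕ}

theorem mul_pow_modEq_mod_two (hb : b * b ≡ 1 [MOD n]) (x k : ℕ) :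
    x * b ^ k ≡ x * b ^ (k % 2) [MOD n] := by
  conv_lhs => rw [← Nat.div_add_mod k 2, pow_add, pow_mul, pow_two]
  simpa using ((hb.pow (k / 2)).mul_right (b ^ (k % 2))).mul_left x

theorem mul_pow_mul_pow_modEq (hb : b * b ≡ 1 [MOD n]) (x k : ℕ) :
    x * b ^ k * b ^ k ≡ x [MOD n] := by
  simpa [mul_pow, mul_assoc] using (hb.pow k).mul_left x

theorem IsMinRep.le_of_modEq {x y k : ℕ} (hx : IsMinRep b n x) (hy : y < n)
    (h : y ≡ x * b ^ k [MOD n]) : x ≤ y := by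
  have := hx.2 k
  rwa [← h, Nat.mod_eq_of_lt hy] at this

theorem IsMinRep.eq_of_modEq (hb : b * b ≡ 1 [MOD n]) {x y k l : ℕ} (hx : IsMinRep b n x)
    (hy : IsMinRep b n y) (h : x * b ^ k ≡ y * b ^ l [MOD n]) : x = y := by
  refine le_antisymm (hx.le_of_modEq (k := k + l) hy.1 ?_) (hy.le_of_modEq (k := l + k) hx.1 ?_)
  · rw [pow_add, ← mul_assoc]
    exact ((h.mul_right _).trans (mul_pow_mul_pow_modEq hb y l)).symm
  · rw [pow_add, ← mul_assoc]
    exact (mul_pow_mul_pow_modEq hb x k).symm.trans (h.mul_right _)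

theorem exists_isMinRep (hb : b * b ≡ 1 [MOD n]) {x : ℕ} (hx : x < n) :
    ∃ y ≤ x, IsMinRep b n y ∧ ∃ k, x = (y * b ^ k) % n := by
  have hn : 0 < n := by omega
  have hmin : ∃ k, min x ((x * b) % n) = (x * b ^ k) % n := by
    rcases min_choice x ((x * b) % n) with h | h
    · exact ⟨0, by rw [h, pow_zero, mul_one, Nat.mod_eq_of_lt hx]⟩
    · exact ⟨1, by rw [h, pow_one]⟩
  obtain ⟨k, hk⟩ := hmin
  have hy : min x ((x * b) % n) ≡ x * b ^ k [MOD n] := by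
    rw [hk]
    exact Nat.mod_modEq _ _
  refine ⟨min x ((x * b) % n), min_le_left _ _, ⟨(min_le_left _ _).trans_lt hx, fun i => ?_⟩,
    k, ?_⟩
  · have h1 : min x ((x * b) % n) * b ^ i ≡ x * b ^ ((k + i) % 2) [MOD n] := by
      refine (hy.mul_right _).trans ?_
      rw [mul_assoc, ← pow_add]
      exact mul_pow_modEq_mod_two hb x (k + i)
    rw [h1]
    rcases Nat.mod_two_eq_zero_or_one (k + i) with h2 | h2
    · rw [h2, pow_zero, mul_one, Nat.mod_eq_of_lt hx]
      exact min_le_left _ _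
    · rw [h2, pow_one]
      exact min_le_right _ _
  · have h1 := (hy.mul_right (b ^ k)).trans (mul_pow_mul_pow_modEq hb x k)
    rw [h1, Nat.mod_eq_of_lt hx]

theorem unionCosets_lt (hn : 0 < n) {t : ℕ} {a : ℕ → ℕ} : ∀ d ∈ unionCosets b n t a, d < n := by
  rintro d ⟨i, -, -, k, rfl⟩
  exact Nat.mod_lt _ hn

theorem mul_mod_mem_unionCosets {t : ℕ} {a : ℕ → ℕ} :
    ∀ d ∈ unionCosets b n t a, (d * b) % n ∈ unionCosets b n t a := by
  rintro d ⟨i, hi, hit, k, rfl⟩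
  exact ⟨i, hi, hit, k + 1, by rw [Nat.mod_mul_mod, pow_succ, mul_assoc]⟩

theorem unionCosets_eq_image (hb : b * b ≡ 1 [MOD n]) (t : ℕ) (a : ℕ → ℕ) :
    unionCosets b n t a = (Finset.image (fun x : ℕ × ℕ => (a x.1 * b ^ x.2) % n)
      (Finset.Icc 1 t ×ˢ Finset.range 2) : Finset ℕ) := by
  ext x
  simp only [unionCosets, Set.mem_ofPred_eq, Finset.coe_image, Set.mem_image, Finset.mem_coe,
    Finset.mem_product, Finset.mem_Icc, Finset.mem_range, Prod.exists]
  constructor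
  · rintro ⟨i, hi, hit, k, rfl⟩
    exact ⟨i, k % 2, ⟨⟨hi, hit⟩, Nat.mod_lt _ two_pos⟩, (mul_pow_modEq_mod_two hb (a i) k).symm⟩
  · rintro ⟨i, k, ⟨⟨hi, hit⟩, -⟩, rfl⟩
    exact ⟨i, hi, hit, k, rfl⟩

theorem card_unionCosets_le (hb : b * b ≡ 1 [MOD n]) (t : ℕ) (a : ℕ → ℕ) :
    Nat.card (unionCosets b n t a) ≤ 2 * t := by
  rw [unionCosets_eq_image hb, Nat.card_coe_set_eq, Set.ncard_coe_finset]
  refine Finset.card_image_le.trans ?_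
  simp [mul_comm]

theorem card_unionCosets_eq (hb : b * b ≡ 1 [MOD n]) {t : ℕ} {a : ℕ → ℕ}
    (hinj : Set.InjOn a (Set.Icc 1 t)) (hrep : ∀ i ∈ Set.Icc 1 t, IsMinRep b n (a i))
    (hne : ∀ i ∈ Set.Icc 1 t, ¬ a i * b ≡ a i [MOD n]) :
    Nat.card (unionCosets b n t a) = 2 * t := by
  rw [unionCosets_eq_image hb, Nat.card_coe_set_eq, Set.ncard_coe_finset,
    Finset.card_image_of_injOn]
  · simp [mul_comm]
  · rintro ⟨i, k⟩ hik ⟨j, l⟩ hjl (heq : a i * b ^ k ≡ a j * b ^ l [MOD n])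
    simp only [Finset.mem_coe, Finset.mem_product, Finset.mem_Icc, Finset.mem_range] at hik hjl
    obtain rfl : i = j := hinj hik.1 hjl.1 ((hrep i hik.1).eq_of_modEq hb (hrep j hjl.1) heq)
    have h0 := hne i hik.1
    obtain ⟨-, hk⟩ := hik
    obtain ⟨-, hl⟩ := hjl
    interval_cases k <;> interval_cases l
    · rfl
    · exact absurd (by simpa using heq.symm) h0
    · exact absurd (by simpa using heq) h0
    · rfl

/-- The exponents of `unionCosets` remain in different classes after the twist `e ↦ -q e`,
when `b = q ^ 2`. -/
theorem not_dvd_add_mul_of_mem_unionCosets {q t : ℕ} (hb : q ^ 2 * q ^ 2 ≡ 1 [MOD n])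
    {a : ℕ → ℕ} (hpos : ∀ i ∈ Set.Icc 1 t, 0 < a i)
    (hbound : ∀ i ∈ Set.Icc 1 t, a i ≤ a t) (hlt : a t * (q + 1) < n) :
    ∀ d ∈ unionCosets (q ^ 2) n t a, ∀ e ∈ unionCosets (q ^ 2) n t a, ¬ n ∣ d + e * q := by
  rintro d ⟨i, hi, hit, k, rfl⟩ e ⟨j, hj, hjt, l, rfl⟩ hdvd
  have hsmall (i j : ℕ) (hi : i ∈ Set.Icc 1 t) (hj : j ∈ Set.Icc 1 t) :
      ¬ a i + a j * q ≡ 0 [MOD n] := by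
    intro h
    have h1 := Nat.le_of_dvd (Nat.add_pos_left (hpos i hi) _) (Nat.modEq_zero_iff_dvd.1 h)
    have h2 := Nat.mul_le_mul_right q (hbound j hj)
    have h3 := hbound i hi
    nlinarith
  have h1 : a i * (q ^ 2) ^ k + a j * (q ^ 2) ^ l * q ≡ 0 [MOD n] :=
    ((Nat.mod_modEq _ n).add ((Nat.mod_modEq _ n).mul_right q)).symm.trans
      (Nat.modEq_zero_iff_dvd.2 hdvd)
  have h2 : a i + a j * (q ^ 2) ^ ((l + k) % 2) * q ≡ 0 [MOD n] := by
    have h3 := h1.mul_right ((q ^ 2) ^ k)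
    rw [zero_mul, add_mul] at h3
    refine Nat.ModEq.trans ?_ h3
    refine (mul_pow_mul_pow_modEq hb (a i) k).symm.add ?_
    have h4 := (mul_pow_modEq_mod_two hb (a j) (l + k)).symm.mul_right q
    refine h4.trans (by ring_nf; rfl)
  rcases Nat.mod_two_eq_zero_or_one (l + k) with h0 | h0
  · rw [h0, pow_zero, mul_one] at h2
    exact hsmall i j ⟨hi, hit⟩ ⟨hj, hjt⟩ h2
  · rw [h0, pow_one] at h2
    refine hsmall j i ⟨hj, hjt⟩ ⟨hi, hit⟩ ?_
    have h3 := h2.mul_right q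
    rw [zero_mul] at h3
    refine Nat.ModEq.trans ?_ h3
    have h4 := (hb.mul_left (a j)).symm.add_right (a i * q)
    rw [mul_one] at h4
    refine h4.trans (by ring_nf; rfl)

theorem not_mul_sq_modEq_self {q x : ℕ} (hq : 0 < q) (hcop : Nat.gcd n (q - 1) = 1)
    (hx : 0 < x) (hlt : x * (q + 1) < n) : ¬ x * q ^ 2 ≡ x [MOD n] := by
  intro h
  obtain ⟨r, rfl⟩ : ∃ r, q = r + 1 := ⟨q - 1, by omega⟩
  rw [Nat.add_sub_cancel] at hcop
  have h1 := (Nat.modEq_iff_dvd' (Nat.le_mul_of_pos_right x (by positivity))).1 h.symm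
  have h2 : x * (r + 1) ^ 2 - x = r * (x * (r + 1 + 1)) := by
    rw [Nat.sub_eq_iff_eq_add (Nat.le_mul_of_pos_right x (by positivity))]
    ring
  rw [h2] at h1
  have h3 := Nat.le_of_dvd (by positivity) (Nat.Coprime.dvd_of_dvd_mul_left hcop h1)
  omega

end CyclotomicCosets

/-- Theorem 5 of the paper: Hermitian self-orthogonality, dimension
and designed distance for the subfield-subcode over `F_{p^{2s}}` of the univariate code
of length `N - 1` (with `N - 1 ∣ p^{4s} - 1`) given by the cyclotomic cosets (with
respect to `p^{2s}`) of the first `t` nonzero minimal representatives, under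
`a t < (N-1)/(p^s + 1)`; moreover `card Δ ≤ 2t`, with equality when
`gcd (N-1) (p^s - 1) = 1`. -/
theorem univariate_subfield_subcode_hermitian_designed
    (p s z t N : ℕ) (hp : p.Prime) (hs : 0 < s)
    (hN : 1 < N) (hNdvd : (N - 1) ∣ (p ^ (4 * s) - 1))
    (F : Type) [Field F] [Fintype F] [DecidableEq F]
    (hF : Fintype.card F = p ^ (4 * s))
    (a : ℕ → ℕ)
    (hmono : StrictMonoOn a (Set.Iic z))
    (hreps : ∀ x : ℕ, (∃ i ≤ z, a i = x) ↔ IsMinRep (p ^ (2 * s)) (N - 1) x)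
    (ht : 1 ≤ t) (htz : t < z)
    (hbound : a t * (p ^ s + 1) < N - 1) :
    (∀ x ∈ subfieldSubcode F (N - 1) (p ^ (2 * s))
        (unionCosets (p ^ (2 * s)) (N - 1) t a),
     ∀ y ∈ subfieldSubcode F (N - 1) (p ^ (2 * s))
        (unionCosets (p ^ (2 * s)) (N - 1) t a),
      ∑ i, x i * y i ^ (p ^ s) = 0) ∧
    Nat.card (subfieldSubcode F (N - 1) (p ^ (2 * s))
        (unionCosets (p ^ (2 * s)) (N - 1) t a)) =
      (p ^ (2 * s)) ^ (Nat.card (unionCosets (p ^ (2 * s)) (N - 1) t a)) ∧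
    (∀ y : ↥(rootsSet F (N - 1)) → F,
      (∀ i, y i ^ (p ^ (2 * s)) = y i) →
      (∀ x ∈ subfieldSubcode F (N - 1) (p ^ (2 * s))
          (unionCosets (p ^ (2 * s)) (N - 1) t a),
        ∑ i, x i * y i ^ (p ^ s) = 0) →
      y ≠ 0 →
      a (t + 1) ≤ (Finset.univ.filter (fun i => y i ≠ 0)).card) ∧
    Nat.card (unionCosets (p ^ (2 * s)) (N - 1) t a) ≤ 2 * t ∧
    (Nat.gcd (N - 1) (p ^ s - 1) = 1 →
      Nat.card (unionCosets (p ^ (2 * s)) (N - 1) t a) = 2 * t) := by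
  have : Fact p.Prime := ⟨hp⟩
  have : CharP F p := charP_of_card_eq_prime_pow hF
  have hq : 0 < p ^ s := pow_pos hp.pos s
  have hsq : p ^ (2 * s) = (p ^ s) ^ 2 := by rw [← pow_mul, mul_comm]
  have hF2 : Fintype.card F = p ^ (2 * s) * p ^ (2 * s) := by
    rw [hF, ← pow_add]
    congr 1
    omega
  generalize N - 1 = n at *
  have hn : 0 < n := by omega
  have hdvd : n ∣ Fintype.card F - 1 := hF ▸ hNdvd
  have hb : p ^ (2 * s) * p ^ (2 * s) ≡ 1 [MOD n] := by
    rw [← hF2]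
    exact ((Nat.modEq_iff_dvd' Fintype.card_pos).2 hdvd).symm
  have hrep (i) (hi : i ≤ z) : IsMinRep (p ^ (2 * s)) n (a i) := (hreps _).1 ⟨i, hi, rfl⟩
  have hle (i) (hi : i ∈ Set.Icc 1 t) : a i ≤ a t :=
    hmono.monotoneOn (Set.mem_Iic.2 (hi.2.trans htz.le)) (Set.mem_Iic.2 htz.le) hi.2
  have hpos (i) (hi : i ∈ Set.Icc 1 t) : 0 < a i :=
    (Nat.zero_le _).trans_lt
      (hmono (Set.mem_Iic.2 (Nat.zero_le z)) (Set.mem_Iic.2 (hi.2.trans htz.le)) hi.1)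
  refine ⟨?_, ?_, ?_, card_unionCosets_le hb t a, ?_⟩
  · intro x hx y hy
    refine sum_mul_pow_eq_zero_of_mem_evalCode hn hdvd ?_ hx.1 hy.1
    rw [hsq] at hb ⊢
    exact not_dvd_add_mul_of_mem_unionCosets hb hpos hle hbound
  · exact card_subfieldSubcode hn (by omega) hF2 hdvd (unionCosets_lt hn) mul_mod_mem_unionCosets
  · intro y _ hy hy0
    have hsupp : ∀ i, y i ^ p ^ s ≠ 0 ↔ y i ≠ 0 := fun i => pow_ne_zero_iff hq.ne'
    have hbch := le_card_support_of_sum_pow_mul_eq_zero (δ := a (t + 1)) hn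
      (w := fun i => y i ^ p ^ s) ?_ ?_
    · simpa only [hsupp] using hbch
    · intro d hd1 hd
      refine sum_mul_eq_zero_of_subfieldSubcode (by omega) hF2 mul_mod_mem_unionCosets hy
        (pow_mem_evalCode (F := F) ?_)
      obtain ⟨c, hcd, hc, k, hk⟩ := exists_isMinRep hb (hd.trans (hrep (t + 1) htz).1)
      obtain ⟨i, hiz, rfl⟩ := (hreps c).2 hc
      have hit : i < t + 1 :=
        (hmono.lt_iff_lt (Set.mem_Iic.2 hiz) (Set.mem_Iic.2 htz)).1 (hcd.trans_lt hd)
      refine ⟨i, Nat.one_le_iff_ne_zero.2 ?_, Nat.lt_succ_iff.1 hit, k, hk⟩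
      rintro rfl
      obtain ⟨j, hjz, hj⟩ := (hreps 0).2 ⟨hn, fun _ => Nat.zero_le _⟩
      have h0 : a 0 = 0 := Nat.le_zero.1 (hj ▸ hmono.monotoneOn
        (Set.mem_Iic.2 (Nat.zero_le z)) (Set.mem_Iic.2 hjz) (Nat.zero_le j))
      rw [h0, zero_mul, Nat.zero_mod] at hk
      omega
    · obtain ⟨i, hi⟩ := Function.ne_iff.1 hy0
      exact Function.ne_iff.2 ⟨i, (hsupp i).2 hi⟩
  · intro hcop
    refine card_unionCosets_eq hb ?_ (fun i hi => hrep i (hi.2.trans htz.le)) fun i hi => ?_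
    · exact hmono.injOn.mono fun i hi => Set.mem_Iic.2 (hi.2.trans htz.le)
    · rw [hsq]
      exact not_mul_sq_modEq_self hq hcop (hpos i hi)
        ((Nat.mul_le_mul_right _ (hle i hi)).trans_lt hbound)
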